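/- For each σ ∈ [0,1), the map f_σ(z) = (σz + z³)/(1 + σz²) is a rational proper map of the unit disc 𝔹₁ to itself of degree 3 written in lowest terms, and every rational proper map f : 𝔹₁ → 𝔹₁ of degree 3 (equivalently, every Blaschke product of three factors) is spherically equivalent to f_σ for exactly one σ ∈ [0,1). -/

import Mathlib

noncomputable section

/-- `p/g` is a rational proper map of the unit disc to itself of degree `d` written in lowest
terms. -/
def IsProperDiscMap (p g : Polynomial ℂ) (d : ℕ) : Prop :=
  (∀ h : Polynomial ℂ, h ∣ g → h ∣ p → IsUnit h) ∧
  (∀ z : ℂ, ‖z‖ < 1 → g.eval z ≠ 0) ∧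
  d = max p.natDegree g.natDegree ∧
  (∀ z : ℂ, ‖z‖ < 1 → Complex.normSq (p.eval z) < Complex.normSq (g.eval z)) ∧
  (∀ z : ℂ, ‖z‖ = 1 → Complex.normSq (g.eval z) - Complex.normSq (p.eval z) = 0)

/-- An automorphism of the unit disc. -/
structure DiscAut : Type where
  toFun : ℂ → ℂ
  invFun : ℂ → ℂ
  maps_ball : ∀ z : ℂ, ‖z‖ < 1 → ‖toFun z‖ < 1
  maps_ball' : ∀ z : ℂ, ‖z‖ < 1 → ‖invFun z‖ < 1
  left_inv : ∀ z : ℂ, ‖z‖ < 1 → invFun (toFun z) = z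
  right_inv : ∀ z : ℂ, ‖z‖ < 1 → toFun (invFun z) = z
  holo : DifferentiableOn ℂ toFun (Metric.ball 0 1)
  holo' : DifferentiableOn ℂ invFun (Metric.ball 0 1)

open Polynomial ComplexConjugate

lemma cdnf_part1 (σ : ℝ) (h0 : 0 ≤ σ) (h1 : σ < 1) :
    IsProperDiscMap (Polynomial.C (σ : ℂ) * Polynomial.X + Polynomial.X ^ 3)
        (1 + Polynomial.C (σ : ℂ) * Polynomial.X ^ 2) 3 := by
  have key : ∀ z : ℂ, Complex.normSq (1 + (σ:ℂ) * z ^ 2) - Complex.normSq ((σ:ℂ) * z + z ^ 3) =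
      (1 - Complex.normSq z) * (1 + Complex.normSq z + Complex.normSq z ^ 2
        + 2 * σ * (z.re ^ 2 - z.im ^ 2) - Complex.normSq z * σ ^ 2) := by
    intro z
    simp only [Complex.normSq_apply, pow_succ, pow_zero, one_mul, Complex.add_re, Complex.add_im,
      Complex.mul_re, Complex.mul_im, Complex.ofReal_re, Complex.ofReal_im, Complex.one_re,
      Complex.one_im]
    ring
  have hlt : ∀ z : ℂ, ‖z‖ < 1 →
      Complex.normSq ((σ:ℂ) * z + z ^ 3) < Complex.normSq (1 + (σ:ℂ) * z ^ 2) := by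
    intro z hz
    have hm : Complex.normSq z < 1 := by
      rw [Complex.normSq_eq_norm_sq]; nlinarith [norm_nonneg z]
    have hm0 := Complex.normSq_nonneg z
    have hre : - Complex.normSq z ≤ z.re ^ 2 - z.im ^ 2 := by
      rw [Complex.normSq_apply]; nlinarith [sq_nonneg z.re]
    have := key z
    generalize Complex.normSq z = m at *
    generalize z.re ^ 2 - z.im ^ 2 = y at *
    have h2 : 0 < 1 + m + m ^ 2 + 2 * σ * y - m * σ ^ 2 := by
      have h3 : 2 * σ * (-m) ≤ 2 * σ * y := by
        apply mul_le_mul_of_nonneg_left hre; linarith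
      have h4 : σ * m ≤ m := by nlinarith
      have h5 : m * σ ^ 2 ≤ m := by nlinarith
      nlinarith
    have := mul_pos (sub_pos.2 hm) h2
    linarith
  refine ⟨?_, ?_, ?_, ?_, ?_⟩
  · intro h hg hp
    have hd : h ∣ C ((1 - σ ^ 2 : ℝ) : ℂ) := by
      have : C ((1 - σ ^ 2 : ℝ) : ℂ) =
        (C (σ:ℂ) * X + X ^ 3) * (C (σ:ℂ) ^ 2 * X) -
        (1 + C (σ:ℂ) * X ^ 2) * (C (σ:ℂ) * X ^ 2 - 1 + C (σ:ℂ) ^ 2) := by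
        push_cast
        simp only [C_sub, C_pow, C_1]
        ring
      rw [this]
      exact dvd_sub (hp.mul_right _) (hg.mul_right _)
    refine isUnit_of_dvd_unit hd ?_
    rw [isUnit_C]
    refine isUnit_iff_ne_zero.2 ?_
    have hpos : 0 < 1 - σ ^ 2 := by nlinarith
    exact_mod_cast hpos.ne'
  · intro z hz h
    have := hlt z hz
    simp only [eval_add, eval_one, eval_mul, eval_C, eval_pow, eval_X] at h
    rw [h] at this
    simp only [map_zero] at this
    exact absurd this (not_lt.2 (Complex.normSq_nonneg _))
  · have a1 : (C (σ:ℂ) * X + X ^ 3 : ℂ[X]).natDegree = 3 := by compute_degree!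
    have a2 : (1 + C (σ:ℂ) * X ^ 2 : ℂ[X]).natDegree ≤ 2 := by compute_degree
    omega
  · intro z hz
    simpa using hlt z hz
  · intro z hz
    have := key z
    simp only [eval_add, eval_one, eval_mul, eval_C, eval_pow, eval_X]
    rw [this, Complex.normSq_eq_norm_sq, hz]; ring

/-! ### Disc automorphisms -/

lemma cdnf_moeb_normSq (a z : ℂ) : Complex.normSq (1 + conj a * z) - Complex.normSq (z + a) =
    (1 - Complex.normSq a) * (1 - Complex.normSq z) := by
  simp only [Complex.normSq_apply, Complex.add_re, Complex.add_im, Complex.mul_re, Complex.mul_im,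
    Complex.one_re, Complex.one_im, Complex.conj_re, Complex.conj_im]
  ring

lemma cdnf_normSq_lt {z : ℂ} : Complex.normSq z < 1 ↔ ‖z‖ < 1 := by
  rw [Complex.normSq_eq_norm_sq]
  constructor <;> intro h <;> nlinarith [norm_nonneg z]

lemma cdnf_den_ne {a z : ℂ} (ha : ‖a‖ < 1) (hz : ‖z‖ ≤ 1) : 1 + conj a * z ≠ 0 := by
  intro h
  have h1 : conj a * z = -1 := by linear_combination h
  have h2 : ‖conj a * z‖ = 1 := by rw [h1]; simp
  rw [norm_mul, RCLike.norm_conj] at h2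
  nlinarith [norm_nonneg a, norm_nonneg z]

lemma cdnf_den_ne' {a z : ℂ} (ha : ‖a‖ < 1) (hz : ‖z‖ ≤ 1) : 1 - conj a * z ≠ 0 := by
  have := cdnf_den_ne (a := -a) (z := z) (by simpa using ha) hz
  intro h
  apply this
  rw [map_neg]
  linear_combination h

lemma cdnf_moeb_lt {a z : ℂ} (ha : ‖a‖ < 1) (hz : ‖z‖ < 1) :
    ‖(z + a) / (1 + conj a * z)‖ < 1 := by
  rw [← cdnf_normSq_lt, map_div₀]
  have h := cdnf_moeb_normSq a z
  have hp : 0 < Complex.normSq (1 + conj a * z) := Complex.normSq_pos.2 (cdnf_den_ne ha hz.le)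
  rw [div_lt_one hp]
  have := mul_pos (sub_pos.2 (cdnf_normSq_lt.2 ha)) (sub_pos.2 (cdnf_normSq_lt.2 hz))
  linarith

lemma cdnf_moeb_inv {a z : ℂ} (ha : ‖a‖ < 1) (hz : ‖z‖ < 1) :
    ((z + a) / (1 + conj a * z) + -a) / (1 + conj (-a) * ((z + a) / (1 + conj a * z))) = z := by
  have h := cdnf_den_ne ha hz.le
  have h2 := cdnf_den_ne (a := -a) (by simpa using ha) (cdnf_moeb_lt ha hz).le
  rw [div_eq_iff h2, map_neg]
  clear h2
  generalize conj a = b at *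
  have e : (z + a) / (1 + b * z) * (1 + b * z) = z + a := div_mul_cancel₀ _ h
  generalize (z + a) / (1 + b * z) = y at *
  linear_combination e

lemma cdnf_moeb_diff {a : ℂ} (ha : ‖a‖ < 1) :
    DifferentiableOn ℂ (fun z => (z + a) / (1 + conj a * z)) (Metric.ball 0 1) := by
  intro z hz
  have h := cdnf_den_ne ha (z := z) (by simpa using (mem_ball_zero_iff.1 hz).le)
  apply DifferentiableAt.differentiableWithinAt
  fun_prop (disch := exact h)

/-- the Moebius automorphism -/
def cdnfMoeb (a : ℂ) (ha : ‖a‖ < 1) : DiscAut where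
  toFun z := (z + a) / (1 + conj a * z)
  invFun z := (z + -a) / (1 + conj (-a) * z)
  maps_ball z hz := cdnf_moeb_lt ha hz
  maps_ball' z hz := cdnf_moeb_lt (by simpa using ha) hz
  left_inv z hz := cdnf_moeb_inv ha hz
  right_inv z hz := by
    have := cdnf_moeb_inv (a := -a) (by simpa using ha) hz
    simpa only [neg_neg] using this
  holo := cdnf_moeb_diff ha
  holo' := cdnf_moeb_diff (by simpa using ha)

/-- rotation -/
def cdnfRot (u : ℂ) (hu : ‖u‖ = 1) : DiscAut where
  toFun z := u * z
  invFun z := u⁻¹ * z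
  maps_ball z hz := by simpa [hu] using hz
  maps_ball' z hz := by simpa [hu] using hz
  left_inv z hz := by
    have : u ≠ 0 := by intro h; simp [h] at hu
    field_simp
  right_inv z hz := by
    have : u ≠ 0 := by intro h; simp [h] at hu
    field_simp
  holo := by fun_prop
  holo' := by fun_prop

/-- composition `A ∘ B` -/
def cdnfComp (A B : DiscAut) : DiscAut where
  toFun z := A.toFun (B.toFun z)
  invFun z := B.invFun (A.invFun z)
  maps_ball z hz := A.maps_ball _ (B.maps_ball _ hz)
  maps_ball' z hz := B.maps_ball' _ (A.maps_ball' _ hz)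
  left_inv z hz := by rw [A.left_inv _ (B.maps_ball _ hz), B.left_inv _ hz]
  right_inv z hz := by rw [B.right_inv _ (A.maps_ball' _ hz), A.right_inv _ hz]
  holo := A.holo.comp B.holo (fun z hz => by
    simpa using B.maps_ball z (by simpa using hz))
  holo' := B.holo'.comp A.holo' (fun z hz => by
    simpa using A.maps_ball' z (by simpa using hz))

/-- inverse -/
def cdnfInv (A : DiscAut) : DiscAut where
  toFun := A.invFun
  invFun := A.toFun
  maps_ball := A.maps_ball'
  maps_ball' := A.maps_ball
  left_inv := A.right_inv
  right_inv := A.left_inv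
  holo := A.holo'
  holo' := A.holo

/-- spherical equivalence -/
def CdnfEqv (f F : ℂ → ℂ) : Prop :=
  ∃ τ ψ : DiscAut, ∀ z : ℂ, ‖z‖ < 1 → τ.toFun (f (ψ.toFun z)) = F z

lemma CdnfEqv.trans {f g h : ℂ → ℂ} (h1 : CdnfEqv f g) (h2 : CdnfEqv g h) : CdnfEqv f h := by
  obtain ⟨t1, p1, h1⟩ := h1
  obtain ⟨t2, p2, h2⟩ := h2
  refine ⟨cdnfComp t2 t1, cdnfComp p1 p2, fun z hz => ?_⟩
  have := h1 _ (p2.maps_ball z hz)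
  rw [← h2 z hz, ← this]
  rfl

lemma CdnfEqv.symm {f g : ℂ → ℂ} (hf : ∀ z, ‖z‖ < 1 → ‖f z‖ < 1) (h1 : CdnfEqv f g) :
    CdnfEqv g f := by
  obtain ⟨t1, p1, h1⟩ := h1
  refine ⟨cdnfInv t1, cdnfInv p1, fun z hz => ?_⟩
  have hz' := p1.maps_ball' z hz
  have := h1 _ hz'
  rw [p1.right_inv z hz] at this
  change t1.invFun (g (p1.invFun z)) = f z
  rw [← this, t1.left_inv _ (hf z hz)]

/-! ### Uniqueness -/

lemma cdnf_pick (ψ : DiscAut) {α β : ℂ} (hα : ‖α‖ < 1) (hβ : ‖β‖ < 1) :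
    ‖(ψ.toFun α - ψ.toFun β) / (1 - conj (ψ.toFun β) * ψ.toFun α)‖ ≤
      ‖(α - β) / (1 - conj β * α)‖ := by
  have hb : ‖-ψ.toFun β‖ < 1 := by simpa using ψ.maps_ball _ hβ
  set G := cdnfComp (cdnfMoeb (-ψ.toFun β) hb) (cdnfComp ψ (cdnfMoeb β hβ)) with hG
  have hG0 : G.toFun 0 = 0 := by simp [hG, cdnfComp, cdnfMoeb]
  have hz := (cdnfMoeb β hβ).maps_ball' α hα
  have := Complex.norm_le_norm_of_mapsTo_ball (f := G.toFun) (R := 1) G.holo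
    (fun z hz => by simpa using (G.maps_ball z (by simpa using hz)).le) hG0 hz
  have e : G.toFun ((cdnfMoeb β hβ).invFun α) =
      (ψ.toFun α - ψ.toFun β) / (1 - conj (ψ.toFun β) * ψ.toFun α) := by
    change (cdnfMoeb (-ψ.toFun β) hb).toFun (ψ.toFun ((cdnfMoeb β hβ).toFun
      ((cdnfMoeb β hβ).invFun α))) = _
    rw [(cdnfMoeb β hβ).right_inv α hα]
    simp [cdnfMoeb, sub_eq_add_neg]
  rw [e] at this
  refine this.trans (le_of_eq ?_)
  simp [cdnfMoeb, sub_eq_add_neg]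

/-- the normal form -/
def cdnfF (σ : ℝ) (z : ℂ) : ℂ := ((σ : ℂ) * z + z ^ 3) / (1 + (σ : ℂ) * z ^ 2)

lemma cdnfF_den {σ : ℝ} (h0 : 0 ≤ σ) (h1 : σ < 1) {z : ℂ} (hz : ‖z‖ < 1) :
    1 + (σ : ℂ) * z ^ 2 ≠ 0 := by
  have := (cdnf_part1 σ h0 h1).2.1 z hz
  simpa using this

lemma cdnfF_lt {σ : ℝ} (h0 : 0 ≤ σ) (h1 : σ < 1) {z : ℂ} (hz : ‖z‖ < 1) :
    ‖cdnfF σ z‖ < 1 := by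
  have := (cdnf_part1 σ h0 h1).2.2.2.1 z hz
  rw [← cdnf_normSq_lt, cdnfF, map_div₀, div_lt_one (Complex.normSq_pos.2 (cdnfF_den h0 h1 hz))]
  simpa using this

lemma cdnfF_deriv {σ : ℝ} (h0 : 0 ≤ σ) (h1 : σ < 1) {z : ℂ} (hz : ‖z‖ < 1) :
    HasDerivAt (cdnfF σ) ((σ * z ^ 4 + (3 - σ ^ 2) * z ^ 2 + σ) / (1 + (σ : ℂ) * z ^ 2) ^ 2) z := by
  have hd := cdnfF_den h0 h1 hz
  have a : HasDerivAt (fun z : ℂ => (σ : ℂ) * z + z ^ 3) (σ + 3 * z ^ 2) z := by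
    have := ((hasDerivAt_id z).const_mul (σ:ℂ)).add (hasDerivAt_pow 3 z)
    refine HasDerivAt.congr_deriv this ?_
    norm_num
  have b : HasDerivAt (fun z : ℂ => 1 + (σ : ℂ) * z ^ 2) (σ * (2 * z)) z := by
    have := ((hasDerivAt_pow 2 z).const_mul (σ:ℂ)).const_add 1
    refine HasDerivAt.congr_deriv this ?_
    norm_num
  refine HasDerivAt.congr_deriv (a.div b hd) ?_
  congr 1
  ring

lemma cdnf_crit_exists {σ : ℝ} (h0 : 0 ≤ σ) (h1 : σ < 1) :
    ∃ c : ℝ, 0 ≤ c ∧ c < 1 ∧ c ^ 2 * σ ^ 2 + (1 + c ^ 4) * σ - 3 * c ^ 2 = 0 := by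
  have hc : ContinuousOn (fun c : ℝ => c ^ 2 * σ ^ 2 + (1 + c ^ 4) * σ - 3 * c ^ 2)
    (Set.Icc 0 1) := by fun_prop
  have := intermediate_value_Icc' (zero_le_one) hc
  obtain ⟨c, hc, h⟩ := this (show (0:ℝ) ∈ _ from ⟨by nlinarith, by nlinarith⟩)
  refine ⟨c, hc.1, lt_of_le_of_ne hc.2 ?_, h⟩
  rintro rfl
  nlinarith [h]

lemma cdnf_crit_at {σ c : ℝ} (h0 : 0 ≤ σ) (h1 : σ < 1)
    (h : c ^ 2 * σ ^ 2 + (1 + c ^ 4) * σ - 3 * c ^ 2 = 0) {z : ℂ} (hz : ‖z‖ < 1)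
    (hzc : z ^ 2 = -(c:ℂ) ^ 2) : HasDerivAt (cdnfF σ) 0 z := by
  convert cdnfF_deriv h0 h1 hz using 1
  have h' : (c:ℂ) ^ 2 * σ ^ 2 + (1 + c ^ 4) * σ - 3 * c ^ 2 = 0 := by exact_mod_cast h
  symm
  rw [div_eq_zero_iff]
  left
  have : z ^ 4 = c ^ 4 := by
    calc z ^ 4 = (z ^ 2) ^ 2 := by ring
      _ = _ := by rw [hzc]; ring
  rw [this, hzc]
  linear_combination h'

lemma cdnf_crit_only {σ c : ℝ} (h0 : 0 ≤ σ) (h1 : σ < 1) (hc0 : 0 ≤ c) (hc1 : c < 1)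
    (h : c ^ 2 * σ ^ 2 + (1 + c ^ 4) * σ - 3 * c ^ 2 = 0) {z : ℂ} (hz : ‖z‖ < 1)
    (hd : HasDerivAt (cdnfF σ) 0 z) : z = Complex.I * c ∨ z = -(Complex.I * c) := by
  have e := hd.unique (cdnfF_deriv h0 h1 hz)
  have h' : (c:ℂ) ^ 2 * σ ^ 2 + (1 + c ^ 4) * σ - 3 * c ^ 2 = 0 := by exact_mod_cast h
  have e2 : σ * z ^ 4 + (3 - σ ^ 2) * z ^ 2 + σ = 0 := by
    rcases div_eq_zero_iff.1 e.symm with h | h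
    · exact h
    · exact absurd h (pow_ne_zero _ (cdnfF_den h0 h1 hz))
  rw [← sq_eq_sq_iff_eq_or_eq_neg, mul_pow, Complex.I_sq]
  rcases hc0.eq_or_lt with rfl | hc
  · have : σ = 0 := by simpa using h
    subst this
    simpa using e2
  · have hs : σ ≠ 0 := by
      rintro rfl
      have : c = 0 := by simpa using h
      exact hc.ne' this
    have f : (σ:ℂ) * (z ^ 2 + c ^ 2) * (c ^ 2 * z ^ 2 + 1) = 0 := by
      linear_combination (c:ℂ) ^ 2 * e2 + z ^ 2 * h'
    have hn : (c:ℂ) ^ 2 * z ^ 2 + 1 ≠ 0 := by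
      have := cdnf_den_ne (a := (c:ℂ) ^ 2) (z := z ^ 2)
        (by rw [norm_pow, Complex.norm_real, Real.norm_of_nonneg hc0]; nlinarith)
        (by rw [norm_pow]; nlinarith [norm_nonneg z])
      rw [map_pow, Complex.conj_ofReal, add_comm] at this
      exact this
    rcases mul_eq_zero.1 f with f | f
    · rcases mul_eq_zero.1 f with f | f
      · exact absurd f (by exact_mod_cast hs)
      · linear_combination f
    · exact absurd f hn

lemma cdnf_crit_le {σ₁ σ₂ c₁ c₂ : ℝ} (h0 : 0 ≤ σ₁) (h1 : σ₁ < 1) (hc0 : 0 ≤ c₁) (hc1 : c₁ < 1)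
    (h : c₁ ^ 2 * σ₁ ^ 2 + (1 + c₁ ^ 4) * σ₁ - 3 * c₁ ^ 2 = 0)
    (h0' : 0 ≤ σ₂) (h1' : σ₂ < 1) (hc0' : 0 ≤ c₂) (hc1' : c₂ < 1)
    (h' : c₂ ^ 2 * σ₂ ^ 2 + (1 + c₂ ^ 4) * σ₂ - 3 * c₂ ^ 2 = 0)
    (hE : CdnfEqv (cdnfF σ₁) (cdnfF σ₂)) : c₁ ≤ c₂ := by
  obtain ⟨τ, ψ, hE⟩ := hE
  have hopen : IsOpen (Metric.ball (0:ℂ) 1) := Metric.isOpen_ball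
  have key : ∀ w : ℂ, ‖w‖ < 1 → w ^ 2 = -(c₁:ℂ) ^ 2 →
      ψ.invFun w = Complex.I * c₂ ∨ ψ.invFun w = -(Complex.I * c₂) := by
    intro w hw hwc
    have hz := ψ.maps_ball' w hw
    apply cdnf_crit_only h0' h1' hc0' hc1' h' hz
    have d1 : HasDerivAt (cdnfF σ₁) 0 (ψ.toFun (ψ.invFun w)) := by
      rw [ψ.right_inv w hw]; exact cdnf_crit_at h0 h1 h hw hwc
    have d2 : HasDerivAt ψ.toFun (deriv ψ.toFun (ψ.invFun w)) (ψ.invFun w) :=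
      (ψ.holo.differentiableAt (hopen.mem_nhds (by simpa using hz))).hasDerivAt
    have hb : ‖cdnfF σ₁ (ψ.toFun (ψ.invFun w))‖ < 1 := by
      rw [ψ.right_inv w hw]; exact cdnfF_lt h0 h1 hw
    have d3 := (τ.holo.differentiableAt (hopen.mem_nhds
      (x := cdnfF σ₁ (ψ.toFun (ψ.invFun w))) (by simpa using hb))).hasDerivAt
    have d4 := d3.comp (ψ.invFun w) (d1.comp (ψ.invFun w) d2)
    rw [zero_mul, mul_zero] at d4
    refine d4.congr_of_eventuallyEq ?_
    filter_upwards [hopen.mem_nhds (show ψ.invFun w ∈ Metric.ball (0:ℂ) 1 by simpa using hz)]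
      with z hz
    exact (hE z (by simpa using hz)).symm
  have n1 : ‖Complex.I * (c₁:ℂ)‖ < 1 := by simpa [abs_of_nonneg hc0] using hc1
  have n2 : ‖-(Complex.I * (c₁:ℂ))‖ < 1 := by simpa [abs_of_nonneg hc0] using hc1
  have k1 := key _ n1 (by rw [mul_pow, Complex.I_sq]; ring)
  have k2 := key _ n2 (by rw [neg_sq, mul_pow, Complex.I_sq]; ring)
  have P := cdnf_pick ψ (ψ.maps_ball' _ n1) (ψ.maps_ball' _ n2)
  rw [ψ.right_inv _ n1, ψ.right_inv _ n2] at P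
  have calc1 : ∀ c : ℝ, 0 ≤ c → ‖(Complex.I * (c:ℂ) - -(Complex.I * (c:ℂ))) /
      (1 - conj (-(Complex.I * (c:ℂ))) * (Complex.I * (c:ℂ)))‖ = 2 * c / (1 + c ^ 2) := by
    intro c hc
    have : (Complex.I * (c:ℂ) - -(Complex.I * (c:ℂ))) /
      (1 - conj (-(Complex.I * (c:ℂ))) * (Complex.I * (c:ℂ))) =
        Complex.I * ((2 * c / (1 + c ^ 2) : ℝ) : ℂ) := by
      simp only [map_neg, map_mul, Complex.conj_I, Complex.conj_ofReal]
      have : (1 - -(-Complex.I * (c:ℂ)) * (Complex.I * c)) = 1 + (c:ℂ) ^ 2 := by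
        linear_combination (- (c:ℂ) ^ 2) * Complex.I_sq
      rw [this]
      push_cast
      ring
    rw [this, norm_mul, Complex.norm_I, one_mul, Complex.norm_real, Real.norm_of_nonneg]
    positivity
  have calc2 : ∀ c : ℝ, 0 ≤ c → ‖(-(Complex.I * (c:ℂ)) - (Complex.I * (c:ℂ))) /
      (1 - conj ((Complex.I * (c:ℂ))) * (-(Complex.I * (c:ℂ))))‖ = 2 * c / (1 + c ^ 2) := by
    intro c hc
    rw [← calc1 c hc, ← norm_neg]
    congr 1
    simp only [map_neg]
    ring
  rw [calc1 _ hc0] at P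
  have P2 : 2 * c₁ / (1 + c₁ ^ 2) ≤ 2 * c₂ / (1 + c₂ ^ 2) := by
    have hpos : 0 ≤ 2 * c₂ / (1 + c₂ ^ 2) := by positivity
    rcases k1 with k1 | k1 <;> rcases k2 with k2 | k2 <;> rw [k1, k2] at P
    · simp only [sub_self, zero_div, norm_zero] at P; linarith
    · rwa [calc1 _ hc0'] at P
    · rwa [calc2 _ hc0'] at P
    · simp only [sub_self, zero_div, norm_zero] at P; linarith
  rw [div_le_div_iff₀ (by positivity) (by positivity)] at P2
  by_contra! hlt
  nlinarith [mul_pos (sub_pos.2 hlt) (show 0 < 1 - c₁ * c₂ by nlinarith)]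

lemma cdnf_unique {σ₁ σ₂ : ℝ} (h0 : 0 ≤ σ₁) (h1 : σ₁ < 1) (h0' : 0 ≤ σ₂) (h1' : σ₂ < 1)
    (hE : CdnfEqv (cdnfF σ₁) (cdnfF σ₂)) : σ₁ = σ₂ := by
  obtain ⟨c, a1, a2, a3⟩ := cdnf_crit_exists h0 h1
  obtain ⟨d, b1, b2, b3⟩ := cdnf_crit_exists h0' h1'
  have e1 := cdnf_crit_le h0 h1 a1 a2 a3 h0' h1' b1 b2 b3 hE
  have e2 := cdnf_crit_le h0' h1' b1 b2 b3 h0 h1 a1 a2 a3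
    (hE.symm (fun z hz => cdnfF_lt h0 h1 hz))
  obtain rfl := le_antisymm e1 e2
  have : (σ₁ - σ₂) * (c ^ 2 * (σ₁ + σ₂) + (1 + c ^ 4)) = 0 := by linear_combination a3 - b3
  rcases mul_eq_zero.1 this with h | h
  · linarith
  · have : 0 < c ^ 2 * (σ₁ + σ₂) + (1 + c ^ 4) := by positivity
    linarith

/-! ### The real one-parameter family -/

/-- the Blaschke product with a double zero at the origin -/
def cdnfH (r : ℝ) (z : ℂ) : ℂ := z ^ 2 * ((z - r) / (1 - r * z))

lemma cdnfH_den {r : ℝ} (h0 : 0 ≤ r) (h1 : r < 1) {z : ℂ} (hz : ‖z‖ < 1) :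
    1 - (r:ℂ) * z ≠ 0 := by
  have := cdnf_den_ne' (a := (r:ℂ)) (z := z) (by simpa [abs_of_nonneg h0] using h1) hz.le
  simpa using this

lemma cdnfH_lt {r : ℝ} (h0 : 0 ≤ r) (h1 : r < 1) {z : ℂ} (hz : ‖z‖ < 1) :
    ‖cdnfH r z‖ < 1 := by
  have := cdnf_moeb_lt (a := -(r:ℂ)) (z := z) (by simpa [abs_of_nonneg h0] using h1) hz
  have e : (z - r) / (1 - r * z) = (z + -(r:ℂ)) / (1 + conj (-(r:ℂ)) * z) := by
    simp [sub_eq_add_neg]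
  rw [cdnfH, e, norm_mul, norm_pow]
  have h2 : ‖z‖ ^ 2 ≤ 1 := by nlinarith [norm_nonneg z]
  nlinarith [norm_nonneg z, norm_nonneg ((z + -(r:ℂ)) / (1 + conj (-(r:ℂ)) * z))]

lemma cdnf_exists_t {r : ℝ} (h0 : 0 ≤ r) (h1 : r < 1) : ∃ t : ℝ, 0 ≤ t ∧ t < 1 ∧
    (t - r) * (1 - r * t) * (1 + t ^ 2) + 2 * t * (1 - 2 * r * t + t ^ 2) = 0 := by
  have hc : ContinuousOn (fun t : ℝ =>
    (t - r) * (1 - r * t) * (1 + t ^ 2) + 2 * t * (1 - 2 * r * t + t ^ 2)) (Set.Icc 0 1) := by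
    fun_prop
  obtain ⟨c, hc, h⟩ := intermediate_value_Icc (zero_le_one) hc
    (show (0:ℝ) ∈ _ from ⟨by nlinarith, by nlinarith⟩)
  refine ⟨c, hc.1, lt_of_le_of_ne hc.2 ?_, h⟩
  rintro rfl
  nlinarith [h]

lemma cdnf_eqv_neg (s : ℝ) : CdnfEqv (cdnfF s) (cdnfF (-s)) := by
  refine ⟨cdnfRot Complex.I (by simp), cdnfRot Complex.I (by simp), fun z _ => ?_⟩
  simp only [cdnfRot, cdnfF]
  have e1 : (s:ℂ) * (Complex.I * z) + (Complex.I * z) ^ 3 = - Complex.I * (-s * z + z ^ 3) := by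
    linear_combination (Complex.I * z ^ 3) * Complex.I_sq
  have e2 : 1 + (s:ℂ) * (Complex.I * z) ^ 2 = 1 + (-s) * z ^ 2 := by
    linear_combination (s * z ^ 2) * Complex.I_sq
  rw [e1, e2]
  push_cast
  rw [← mul_div_assoc, ← mul_assoc]
  congr 1
  linear_combination (-(-s * z + z ^ 3)) * Complex.I_sq

lemma cdnf_H_eqv {r : ℝ} (h0 : 0 ≤ r) (h1 : r < 1) : ∃ s : ℝ, |s| < 1 ∧
    CdnfEqv (cdnfH r) (cdnfF s) := by
  obtain ⟨t, ht0, ht1, hk⟩ := cdnf_exists_t h0 h1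
  set q2 : ℝ := (1 - r ^ 2) + (1 + t ^ 2) * (t - r) ^ 2 with hq2
  set q0 : ℝ := 2 * t * (t - r) * (1 - r * t) + t ^ 2 * (1 - r ^ 2) with hq0
  have hr2 : 0 < 1 - r ^ 2 := by nlinarith
  have ht2 : 0 < 1 - t ^ 2 := by nlinarith
  have hq2p : 0 < q2 := by positivity
  have hsub : q2 - q0 = (1 - t ^ 2) ^ 2 := by rw [hq2, hq0]; ring
  have hadd : q2 + q0 = ((1 - r * t) + t * (t - r)) ^ 2 + 2 * t ^ 2 * (1 - r ^ 2) := by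
    rw [hq2, hq0]; ring
  have hBpos : 0 < 1 - r * t := by nlinarith
  have hadd' : 0 < q2 + q0 := by
    rcases ht0.eq_or_lt with h | h
    · rw [hadd, ← h]; norm_num
    · rw [hadd]; positivity
  have hs : |q0 / q2| < 1 := by
    rw [abs_div, abs_of_pos hq2p, div_lt_one hq2p, abs_lt]
    constructor
    · linarith
    · have : 0 < (1 - t ^ 2) ^ 2 := by positivity
      linarith
  refine ⟨q0 / q2, hs, ?_⟩
  have htn : ‖(t:ℂ)‖ < 1 := by simpa [abs_of_nonneg ht0] using ht1
  have hw := cdnfH_lt h0 h1 htn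
  refine ⟨cdnfMoeb (-cdnfH r t) (by simpa using hw), cdnfMoeb t htn, fun z hz => ?_⟩
  have hy := cdnf_moeb_lt htn hz
  have hwc : conj (cdnfH r t) = cdnfH r t := by simp [cdnfH]
  have hHy := cdnfH_lt h0 h1 hy
  have hyd := cdnfH_den h0 h1 hy
  have hd1 := cdnf_den_ne htn hz.le
  have hden := cdnf_den_ne' hw hHy.le
  have hE := cdnf_den_ne (a := ((q0 / q2 : ℝ) : ℂ)) (z := z ^ 2)
    (by rw [Complex.norm_real]; exact hs) (by rw [norm_pow]; nlinarith [norm_nonneg z])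
  rw [Complex.conj_ofReal] at hE hd1 hHy hy hyd hden
  rw [hwc] at hden
  simp only [cdnfMoeb, Complex.conj_ofReal, map_neg, hwc]
  have hqs : ((q0 / q2 : ℝ) : ℂ) * q2 = q0 := by
    rw [← Complex.ofReal_mul, div_mul_cancel₀ _ hq2p.ne']
  have hB : (1 - (r:ℂ) * t) ≠ 0 := by exact_mod_cast hBpos.ne'
  have hwB : cdnfH r t * (1 - (r:ℂ) * t) = t ^ 2 * (t - r) := by
    rw [cdnfH, mul_assoc, div_mul_cancel₀ _ hB]
  set y := (z + t) / (1 + (t:ℂ) * z) with hyy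
  have hyz : y * (1 + t * z) = z + t := div_mul_cancel₀ _ hd1
  have hHy' : cdnfH r y * (1 - r * y) = y ^ 2 * (y - r) := by
    rw [cdnfH, mul_assoc, div_mul_cancel₀ _ hyd]
  have hD0 : (1 - (r:ℂ) * y) * (1 + t * z) = (1 - r * t) + (t - r) * z := by
    linear_combination (-r : ℂ) * hyz
  have hD : (1 - (r:ℂ) * t) + (t - r) * z ≠ 0 := by
    rw [← hD0]; exact mul_ne_zero hyd hd1
  have hN : cdnfH r y * ((1 + t * z) ^ 2 * ((1 - r * t) + (t - r) * z)) =
      (z + t) ^ 2 * ((t - r) + (1 - r * t) * z) := by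
    have e : (y - r) * (1 + t * z) = (t - r) + (1 - r * t) * z := by linear_combination hyz
    rw [← hD0, ← e, ← hyz]
    linear_combination (1 + t * z) ^ 3 * hHy'
  have hk' : ((t:ℂ) - r) * (1 - r * t) * (1 + t ^ 2) + 2 * t * (1 - 2 * r * t + t ^ 2) = 0 := by
    exact_mod_cast hk
  have hq2' : (q2:ℂ) = (1 - r ^ 2) + (1 + t ^ 2) * (t - r) ^ 2 := by rw [hq2]; push_cast; ring
  have hq0' : (q0:ℂ) = 2 * t * (t - r) * (1 - r * t) + t ^ 2 * (1 - r ^ 2) := by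
    rw [hq0]; push_cast; ring
  have hq2n : (q2:ℂ) ≠ 0 := by exact_mod_cast hq2p.ne'
  have hden' : 1 + -cdnfH r t * cdnfH r y ≠ 0 := by
    intro h; apply hden; linear_combination h
  rw [cdnfF, div_eq_div_iff hden' hE]
  generalize cdnfH r t = w at *
  generalize cdnfH r y = v at *
  generalize ((q0 / q2 : ℝ) : ℂ) = s at *
  have hDD : (1 + (t:ℂ) * z) ^ 2 * ((1 - r * t) + (t - r) * z) ≠ 0 :=
    mul_ne_zero (pow_ne_zero _ hd1) hD
  -- the two real identities
  have i1 : (1 - (r:ℂ) * t) * ((z + t) ^ 2 * ((t - r) + (1 - r * t) * z)) -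
      t ^ 2 * (t - r) * ((1 + t * z) ^ 2 * ((1 - r * t) + (t - r) * z)) =
      (1 - t ^ 2) * (q0 * z + q2 * z ^ 3) := by
    rw [hq2', hq0']
    linear_combination (1 - (t:ℂ) ^ 2) * z ^ 2 * hk'
  have i2 : (1 - (r:ℂ) * t) * ((1 + t * z) ^ 2 * ((1 - r * t) + (t - r) * z)) -
      t ^ 2 * (t - r) * ((z + t) ^ 2 * ((t - r) + (1 - r * t) * z)) =
      (1 - t ^ 2) * (q2 + q0 * z ^ 2) := by
    rw [hq2', hq0']
    linear_combination (1 - (t:ℂ) ^ 2) * z * hk'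
  generalize (1 + (t:ℂ) * z) ^ 2 * ((1 - r * t) + (t - r) * z) = D at *
  generalize (z + (t:ℂ)) ^ 2 * ((t - r) + (1 - r * t) * z) = N at *
  generalize (1 - (r:ℂ) * t) = B at *
  have hfin : (D * B * q2) * ((v + -w) * (1 + s * z ^ 2)) =
      (D * B * q2) * ((s * z + z ^ 3) * (1 + -w * v)) := by
    have j1 : D * B * (v + -w) = (1 - t ^ 2) * (q0 * z + q2 * z ^ 3) := by
      rw [← i1]; linear_combination B * hN - D * hwB
    have j2 : D * B * (1 + -w * v) = (1 - t ^ 2) * (q2 + q0 * z ^ 2) := by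
      rw [← i2]; linear_combination (- w * B) * hN - N * hwB
    calc _ = (D * B * (v + -w)) * (q2 + (s * q2) * z ^ 2) := by ring
      _ = ((s * q2) * z + q2 * z ^ 3) * (D * B * (1 + -w * v)) := by
        rw [j1, j2, hqs]; ring
      _ = _ := by ring
  exact mul_left_cancel₀ (mul_ne_zero (mul_ne_zero hDD hB) hq2n) hfin

lemma cdnf_H_eqv' {r : ℝ} (h0 : 0 ≤ r) (h1 : r < 1) : ∃ s : ℝ, 0 ≤ s ∧ s < 1 ∧
    CdnfEqv (cdnfH r) (cdnfF s) := by
  obtain ⟨s, hs, h⟩ := cdnf_H_eqv h0 h1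
  rw [abs_lt] at hs
  rcases le_total 0 s with h' | h'
  · exact ⟨s, h', hs.2, h⟩
  · exact ⟨-s, by linarith, by linarith, h.trans (cdnf_eqv_neg s)⟩

/-! ### Existence of a critical point -/

lemma cdnf_crit_root {a b c : ℂ} (ha : ‖a‖ < 1) (hb : ‖b‖ < 1) (hc : ‖c‖ < 1) :
    ∃ z : ℂ, ‖z‖ < 1 ∧
      (1 - a * conj a) * ((z - b) * (1 - conj b * z)) * ((z - c) * (1 - conj c * z)) +
      (1 - b * conj b) * ((z - a) * (1 - conj a * z)) * ((z - c) * (1 - conj c * z)) +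
      (1 - c * conj c) * ((z - a) * (1 - conj a * z)) * ((z - b) * (1 - conj b * z)) = 0 := by
  set V : ℂ[X] :=
      C (1 - a * conj a) * ((X - C b) * (1 - C (conj b) * X)) * ((X - C c) * (1 - C (conj c) * X)) +
      C (1 - b * conj b) * ((X - C a) * (1 - C (conj a) * X)) * ((X - C c) * (1 - C (conj c) * X)) +
      C (1 - c * conj c) * ((X - C a) * (1 - C (conj a) * X)) * ((X - C b) * (1 - C (conj b) * X))
    with hV
  have hev : ∀ z : ℂ, V.eval z =
      (1 - a * conj a) * ((z - b) * (1 - conj b * z)) * ((z - c) * (1 - conj c * z)) +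
      (1 - b * conj b) * ((z - a) * (1 - conj a * z)) * ((z - c) * (1 - conj c * z)) +
      (1 - c * conj c) * ((z - a) * (1 - conj a * z)) * ((z - b) * (1 - conj b * z)) := by
    intro z
    rw [hV]
    simp only [eval_add, eval_mul, eval_sub, eval_C, eval_X, eval_one]
  suffices h : ∃ z : ℂ, ‖z‖ < 1 ∧ V.eval z = 0 by
    obtain ⟨z, hz, h⟩ := h
    exact ⟨z, hz, by rw [← hev, h]⟩
  have hinv : ∀ z : ℂ, z ≠ 0 → z ^ 4 * conj (V.eval (conj z)⁻¹) = V.eval z := by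
    intro z hz
    have k : ∀ b : ℂ, conj (((conj z)⁻¹ - b) * (1 - conj b * (conj z)⁻¹)) =
        ((z - b) * (1 - conj b * z)) / z ^ 2 := by
      intro b
      simp only [map_mul, map_sub, map_inv₀, Complex.conj_conj, map_one]
      field_simp
    have k2 : ∀ b : ℂ, conj (1 - b * conj b) = 1 - b * conj b := by
      intro b; simp [mul_comm]
    rw [hev, hev]
    simp only [map_add, map_mul (starRingEnd ℂ) (_ * _) (_ * _),
      map_mul (starRingEnd ℂ) (1 - _ * _) (_ * _), k, k2]
    field_simp
  have hcirc : ∀ z : ℂ, ‖z‖ = 1 → V.eval z ≠ 0 := by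
    intro z hz h
    have hzz : z * conj z = 1 := by rw [Complex.mul_conj, Complex.normSq_eq_norm_sq, hz]; simp
    have hz0 : z ≠ 0 := by intro h; simp [h] at hz
    have k : ∀ b : ℂ, (z - b) * (1 - conj b * z) = z * (Complex.normSq (z - b) : ℂ) := by
      intro b
      rw [← Complex.mul_conj, map_sub]
      linear_combination (-(z - b)) * hzz
    have k2 : ∀ b : ℂ, 1 - b * conj b = ((1 - Complex.normSq b : ℝ) : ℂ) := by
      intro b; rw [Complex.mul_conj]; push_cast; ring
    have k3 : ∀ b : ℂ, ‖b‖ < 1 → 0 < 1 - Complex.normSq b := by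
      intro b hb; have := cdnf_normSq_lt.2 hb; linarith
    have k4 : ∀ b : ℂ, ‖b‖ < 1 → 0 < Complex.normSq (z - b) := by
      intro b hb
      rw [Complex.normSq_pos, sub_ne_zero]
      rintro rfl
      linarith
    rw [hev, k, k, k, k2, k2, k2] at h
    have a1 := k3 a ha
    have b1 := k3 b hb
    have c1 := k3 c hc
    have a2 := k4 a ha
    have b2 := k4 b hb
    have c2 := k4 c hc
    generalize 1 - Complex.normSq a = A at *
    generalize 1 - Complex.normSq b = B at *
    generalize 1 - Complex.normSq c = Cc at *
    generalize Complex.normSq (z - a) = A' at *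
    generalize Complex.normSq (z - b) = B' at *
    generalize Complex.normSq (z - c) = C' at *
    have hp : 0 < A * B' * C' + B * A' * C' + Cc * A' * B' := by positivity
    have : z ^ 2 * ((A * B' * C' + B * A' * C' + Cc * A' * B' : ℝ) : ℂ) = 0 := by
      rw [← h]; push_cast; ring
    rcases mul_eq_zero.1 this with h | h
    · exact pow_ne_zero _ hz0 h
    · exact hp.ne' (by exact_mod_cast h)
  obtain ⟨x, hx⟩ : ∃ x, V.eval x = 0 := by
    by_cases hd : V.degree = 0
    · exfalso
      have hCV := Polynomial.eq_C_of_degree_eq_zero hd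
      set v := V.coeff 0
      have hc1 := hinv 1 one_ne_zero
      have hc2 := hinv 2 two_ne_zero
      have hv : v ≠ 0 := by
        have := hcirc 1 (by simp)
        rwa [hCV, eval_C] at this
      rw [hCV] at hc1 hc2
      simp only [eval_C, one_pow, one_mul] at hc1 hc2
      rw [hc1] at hc2
      apply hv
      linear_combination hc2 / 15
    · exact IsAlgClosed.exists_root V hd
  rcases lt_trichotomy ‖x‖ 1 with h | h | h
  · exact ⟨x, h, hx⟩
  · exact absurd hx (hcirc x h)
  · have hx0 : x ≠ 0 := by intro h'; rw [h'] at h; simp at h; linarith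
    refine ⟨(conj x)⁻¹, ?_, ?_⟩
    · rw [norm_inv, RCLike.norm_conj]; exact inv_lt_one_of_one_lt₀ h
    · have := hinv x hx0
      rw [hx] at this
      rcases mul_eq_zero.1 this with h | h
      · exact absurd h (pow_ne_zero _ hx0)
      · simpa using h


/-! ### Blaschke factorisation -/

/-- conjugate reflected polynomial of formal degree three -/
def cdnfStar (q : ℂ[X]) : ℂ[X] :=
  C (conj (q.coeff 3)) + C (conj (q.coeff 2)) * X + C (conj (q.coeff 1)) * X ^ 2 +
    C (conj (q.coeff 0)) * X ^ 3

lemma cdnf_expand {q : ℂ[X]} (hq : q.natDegree ≤ 3) :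
    q = C (q.coeff 0) + C (q.coeff 1) * X + C (q.coeff 2) * X ^ 2 + C (q.coeff 3) * X ^ 3 := by
  conv_lhs => rw [q.as_sum_range_C_mul_X_pow' (show q.natDegree < 4 by omega)]
  simp [Finset.sum_range_succ]

lemma cdnfStar_coeff (q : ℂ[X]) : (cdnfStar q).coeff 0 = conj (q.coeff 3) ∧
    (cdnfStar q).coeff 1 = conj (q.coeff 2) ∧ (cdnfStar q).coeff 2 = conj (q.coeff 1) ∧
    (cdnfStar q).coeff 3 = conj (q.coeff 0) := by
  simp [cdnfStar, coeff_X, coeff_C, coeff_X_pow]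

lemma cdnfStar_natDegree (q : ℂ[X]) : (cdnfStar q).natDegree ≤ 3 := by
  unfold cdnfStar; compute_degree

lemma cdnfStar_star {q : ℂ[X]} (hq : q.natDegree ≤ 3) : cdnfStar (cdnfStar q) = q := by
  obtain ⟨h0, h1, h2, h3⟩ := cdnfStar_coeff q
  conv_rhs => rw [cdnf_expand hq]
  rw [cdnfStar, h0, h1, h2, h3]
  simp

lemma cdnfStar_eval {q : ℂ[X]} (hq : q.natDegree ≤ 3) {z : ℂ} (hz : z ≠ 0) :
    (cdnfStar q).eval z = z ^ 3 * conj (q.eval (conj z)⁻¹) := by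
  conv_rhs => rw [cdnf_expand hq]
  simp only [cdnfStar, eval_add, eval_mul, eval_C, eval_X, eval_pow, map_add, map_mul, map_pow,
    map_inv₀, Complex.conj_conj]
  field_simp
  ring

lemma cdnfStar_C_mul (k : ℂ) (q : ℂ[X]) : cdnfStar (C k * q) = C (conj k) * cdnfStar q := by
  simp only [cdnfStar, coeff_C_mul, map_mul]
  ring

lemma cdnfStar_explicit (a b c d : ℂ) : cdnfStar (C a + C b * X + C c * X ^ 2 + C d * X ^ 3) =
    C (conj d) + C (conj c) * X + C (conj b) * X ^ 2 + C (conj a) * X ^ 3 := by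
  rw [cdnfStar]
  simp [coeff_X, coeff_C, coeff_X_pow]

lemma cdnfStar_prod (κ a b c : ℂ) : cdnfStar (C κ * (X - C a) * (X - C b) * (X - C c)) =
    C (conj κ) * (1 - C (conj a) * X) * (1 - C (conj b) * X) * (1 - C (conj c) * X) := by
  have e : C κ * (X - C a) * (X - C b) * (X - C c) =
    C (-(κ * a * b * c)) + C (κ * (a * b + a * c + b * c)) * X + C (-(κ * (a + b + c))) * X ^ 2
      + C κ * X ^ 3 := by
    simp only [C_mul, C_neg, C_add]
    ring
  rw [e, cdnfStar_explicit]
  simp only [map_neg, map_mul, map_add]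
  ring

lemma cdnf_blaschke {p g : ℂ[X]} (h : IsProperDiscMap p g 3) : ∃ κ μ a b c : ℂ,
    κ ≠ 0 ∧ ‖κ‖ = ‖μ‖ ∧ ‖a‖ < 1 ∧ ‖b‖ < 1 ∧ ‖c‖ < 1 ∧
    p = C κ * (X - C a) * (X - C b) * (X - C c) ∧
    g = C μ * (1 - C (conj a) * X) * (1 - C (conj b) * X) * (1 - C (conj c) * X) := by
  obtain ⟨hcop, hg0, hdeg, hlt, hcirc⟩ := h
  have hpd : p.natDegree ≤ 3 := by omega
  have hgd : g.natDegree ≤ 3 := by omega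
  have hrel : IsCoprime g p := IsRelPrime.isCoprime (fun d h1 h2 => hcop d h1 h2)
  -- the circle as an infinite set
  have hinf : Set.Infinite {z : ℂ | ‖z‖ = 1} := by
    have h1 : Set.Infinite (Metric.sphere (0:ℂ) 1) := by
      have := (isPreconnected_sphere (E := ℂ) (by simp) 0 1)
      refine this.infinite_of_nontrivial ⟨1, by simp, -1, by simp, ?_⟩
      norm_num
    convert h1 using 1
    ext z; simp
  have hid : p * cdnfStar p = g * cdnfStar g := by
    apply Polynomial.eq_of_infinite_eval_eq
    refine hinf.mono ?_
    intro z hz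
    have hz' : ‖z‖ = 1 := hz
    have hz0 : z ≠ 0 := by intro h; simp [h] at hz'
    have hzz : z * conj z = 1 := by rw [Complex.mul_conj, Complex.normSq_eq_norm_sq, hz']; simp
    have hzi : (conj z)⁻¹ = z := by rw [inv_eq_iff_eq_inv]; exact eq_inv_of_mul_eq_one_right hzz
    simp only [Set.mem_ofPred_eq, eval_mul]
    rw [cdnfStar_eval hpd hz0, cdnfStar_eval hgd hz0, hzi]
    have h1 : p.eval z * conj (p.eval z) = g.eval z * conj (g.eval z) := by
      rw [Complex.mul_conj, Complex.mul_conj, sub_eq_zero.1 (hcirc z hz')]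
    linear_combination z ^ 3 * h1
  have hg00 : g.coeff 0 ≠ 0 := by
    rw [coeff_zero_eq_eval_zero]; exact hg0 0 (by simp)
  have hp0 : p ≠ 0 := by
    rintro rfl
    have := hcop g dvd_rfl (dvd_zero _)
    rw [natDegree_eq_zero_of_isUnit this] at hdeg
    simp at hdeg
  obtain ⟨k, hk⟩ : p ∣ cdnfStar g := by
    refine hrel.symm.dvd_of_dvd_mul_left ?_
    rw [← hid]; exact dvd_mul_right _ _
  have hk2 : cdnfStar p = g * k := by
    apply mul_left_cancel₀ hp0
    rw [hid, hk]; ring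
  have hgs : cdnfStar g ≠ 0 := by
    intro h0
    have := (cdnfStar_coeff g).2.2.2
    rw [h0, coeff_zero] at this
    exact hg00 (by simpa using this.symm)
  have hgne : g ≠ 0 := by rintro rfl; simp at hg00
  have hk0 : k ≠ 0 := by rintro rfl; rw [mul_zero] at hk; exact hgs hk
  have d1 : p.natDegree + k.natDegree ≤ 3 := by
    rw [← natDegree_mul hp0 hk0, ← hk]; exact cdnfStar_natDegree g
  have d2 : g.natDegree + k.natDegree ≤ 3 := by
    rw [← natDegree_mul hgne hk0, ← hk2]; exact cdnfStar_natDegree p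
  have hkd : k.natDegree = 0 := by
    rcases max_choice p.natDegree g.natDegree with h | h <;> omega
  have d3 : p.natDegree = 3 := by
    have h3 : 3 ≤ (cdnfStar g).natDegree := by
      apply le_natDegree_of_ne_zero
      rw [(cdnfStar_coeff g).2.2.2]
      simpa using hg00
    rw [hk, natDegree_mul hp0 hk0] at h3
    omega
  obtain ⟨k₀, rfl⟩ : ∃ k₀, k = C k₀ := ⟨_, eq_C_of_natDegree_eq_zero hkd⟩
  have hk00 : k₀ ≠ 0 := by rintro rfl; simp at hk0
  have hgp : g = C (conj k₀) * cdnfStar p := by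
    rw [← cdnfStar_C_mul, mul_comm, ← hk, cdnfStar_star hgd]
  -- roots
  have hsp := IsAlgClosed.splits p
  have hcard : p.roots.card = 3 := by rw [← d3]; exact hsp.natDegree_eq_card_roots.symm
  have hprod := hsp.eq_prod_roots
  obtain ⟨a, b, c, habc⟩ := Multiset.card_eq_three.1 hcard
  rw [habc] at hprod
  have hP : p = C p.leadingCoeff * (X - C a) * (X - C b) * (X - C c) := by
    rw [hprod]
    simp [mul_assoc]
  have hroot : ∀ x : ℂ, p.eval x = 0 → ‖x‖ < 1 := by
    intro x hx
    by_contra! hge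
    have hx0 : x ≠ 0 := by intro h; rw [h] at hge; simp at hge; linarith
    have e : (cdnfStar g).eval x = 0 := by rw [hk, eval_mul, hx, zero_mul]
    rw [cdnfStar_eval hgd hx0] at e
    have e2 : g.eval (conj x)⁻¹ = 0 := by
      rcases mul_eq_zero.1 e with h | h
      · exact absurd h (pow_ne_zero _ hx0)
      · simpa using h
    rcases hge.eq_or_lt with h1 | h1
    · have := hcirc x h1.symm
      rw [hx] at this
      have hgx : g.eval x = 0 := by simpa using this
      have := hcop (X - C x) (dvd_iff_isRoot.2 hgx) (dvd_iff_isRoot.2 hx)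
      exact not_isUnit_X_sub_C x this
    · refine hg0 _ ?_ e2
      rw [norm_inv, RCLike.norm_conj]; exact inv_lt_one_of_one_lt₀ h1
  have hlc : p.leadingCoeff ≠ 0 := leadingCoeff_ne_zero.2 hp0
  have ha : ‖a‖ < 1 := hroot a (by rw [hP]; simp)
  have hb : ‖b‖ < 1 := hroot b (by rw [hP]; simp)
  have hc : ‖c‖ < 1 := hroot c (by rw [hP]; simp)
  generalize p.leadingCoeff = κ at *
  have hG : g = C (conj k₀ * conj κ) * (1 - C (conj a) * X) * (1 - C (conj b) * X) *
      (1 - C (conj c) * X) := by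
    rw [hgp, hP, cdnfStar_prod, C_mul]; ring
  refine ⟨κ, conj k₀ * conj κ, a, b, c, hlc, ?_, ha, hb, hc, hP, hG⟩
  have h1 := hcirc 1 (by simp)
  rw [hP, hG] at h1
  simp only [eval_mul, eval_C, eval_sub, eval_X, eval_one, mul_one] at h1
  have kk : ∀ a : ℂ, ‖a‖ < 1 → ‖1 - conj a‖ = ‖1 - a‖ ∧ 0 < ‖1 - a‖ := by
    intro a ha
    constructor
    · rw [← RCLike.norm_conj]; simp
    · rw [norm_pos_iff, sub_ne_zero]; rintro rfl; simp at ha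
  have h2 := sub_eq_zero.1 h1
  rw [Complex.normSq_eq_norm_sq, Complex.normSq_eq_norm_sq,
    sq_eq_sq₀ (norm_nonneg _) (norm_nonneg _), norm_mul, norm_mul, norm_mul, norm_mul (κ * _ * _),
    norm_mul (κ * _), norm_mul κ, (kk a ha).1, (kk b hb).1, (kk c hc).1] at h2
  have := (kk a ha).2
  have := (kk b hb).2
  have := (kk c hc).2
  exact (mul_right_cancel₀ (by positivity) (mul_right_cancel₀ (by positivity)
    (mul_right_cancel₀ (by positivity) h2))).symm

lemma cdnf_post {p g : ℂ[X]} (h : IsProperDiscMap p g 3) {w : ℂ} (hw : ‖w‖ < 1) :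
    IsProperDiscMap (p - C w * g) (g - C (conj w) * p) 3 := by
  obtain ⟨hcop, hg0, hdeg, hlt, hcirc⟩ := h
  have hpd : p.natDegree ≤ 3 := by omega
  have hgd : g.natDegree ≤ 3 := by omega
  have hwp : 0 < 1 - Complex.normSq w := by have := cdnf_normSq_lt.2 hw; linarith
  have hid : ∀ x y : ℂ, Complex.normSq (y - conj w * x) - Complex.normSq (x - w * y) =
      (1 - Complex.normSq w) * (Complex.normSq y - Complex.normSq x) := by
    intro x y
    simp only [Complex.normSq_apply, Complex.sub_re, Complex.sub_im, Complex.mul_re,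
      Complex.mul_im, Complex.conj_re, Complex.conj_im]
    ring
  have hww : (1 - conj w * w) ≠ 0 := by
    rw [mul_comm, Complex.mul_conj]; exact_mod_cast hwp.ne'
  have e1 : p = C (1 - conj w * w)⁻¹ * ((p - C w * g) + C w * (g - C (conj w) * p)) := by
    have : (p - C w * g) + C w * (g - C (conj w) * p) = C (1 - conj w * w) * p := by
      simp only [C_sub, C_mul, C_1]; ring
    rw [this, ← mul_assoc, ← C_mul, inv_mul_cancel₀ hww, C_1, one_mul]
  have e2 : g = C (1 - conj w * w)⁻¹ * ((g - C (conj w) * p) + C (conj w) * (p - C w * g)) := by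
    have : (g - C (conj w) * p) + C (conj w) * (p - C w * g) = C (1 - conj w * w) * g := by
      simp only [C_sub, C_mul, C_1]; ring
    rw [this, ← mul_assoc, ← C_mul, inv_mul_cancel₀ hww, C_1, one_mul]
  have hlt' : ∀ z : ℂ, ‖z‖ < 1 → Complex.normSq ((p - C w * g).eval z) <
      Complex.normSq ((g - C (conj w) * p).eval z) := by
    intro z hz
    simp only [eval_sub, eval_mul, eval_C]
    have := hid (p.eval z) (g.eval z)
    have := mul_pos hwp (sub_pos.2 (hlt z hz))
    linarith
  have key : ∀ (q₁ q₂ : ℂ[X]) (u v : ℂ) (n : ℕ), q₁.natDegree ≤ n → q₂.natDegree ≤ n →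
      (C v * (q₁ + C u * q₂)).natDegree ≤ n := by
    intro q₁ q₂ u v n h1 h2
    refine (natDegree_C_mul_le _ _).trans ((natDegree_add_le _ _).trans (max_le h1 ?_))
    exact (natDegree_C_mul_le _ _).trans h2
  have key2 : ∀ (q₁ q₂ : ℂ[X]) (u : ℂ) (n : ℕ), q₁.natDegree ≤ n → q₂.natDegree ≤ n →
      (q₁ - C u * q₂).natDegree ≤ n := by
    intro q₁ q₂ u n h1 h2
    refine ((natDegree_sub_le _ _).trans (max_le h1 ?_))
    exact (natDegree_C_mul_le _ _).trans h2
  refine ⟨?_, ?_, ?_, hlt', ?_⟩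
  · intro d h1 h2
    apply hcop d
    · rw [e2]; exact (dvd_add h1 (h2.mul_left _)).mul_left _
    · rw [e1]; exact (dvd_add h2 (h1.mul_left _)).mul_left _
  · intro z hz h0
    have := hlt' z hz
    rw [h0, map_zero] at this
    exact absurd this (not_lt.2 (Complex.normSq_nonneg _))
  · apply le_antisymm
    · conv_lhs => rw [hdeg]
      apply max_le
      · conv_lhs => rw [e1]
        exact key _ _ _ _ _ (le_max_left _ _) (le_max_right _ _)
      · conv_lhs => rw [e2]
        exact key _ _ _ _ _ (le_max_right _ _) (le_max_left _ _)
    · exact max_le (key2 _ _ _ _ hpd hgd) (key2 _ _ _ _ hgd hpd)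
  · intro z hz
    simp only [eval_sub, eval_mul, eval_C]
    rw [hid, hcirc z hz, mul_zero]

/-- a critical point of a cubic proper map -/
lemma cdnf_crit_pg {p g : ℂ[X]} (h : IsProperDiscMap p g 3) : ∃ ζ : ℂ, ‖ζ‖ < 1 ∧
    (derivative p).eval ζ * g.eval ζ - p.eval ζ * (derivative g).eval ζ = 0 := by
  obtain ⟨κ, μ, a, b, c, -, -, ha, hb, hc, rfl, rfl⟩ := cdnf_blaschke h
  obtain ⟨ζ, hζ, hV⟩ := cdnf_crit_root ha hb hc
  refine ⟨ζ, hζ, ?_⟩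
  simp only [derivative_mul, derivative_sub, derivative_C, derivative_X, derivative_one,
    eval_mul, eval_add, eval_sub, eval_C, eval_X, eval_one, eval_zero]
  linear_combination κ * μ * hV

lemma cdnf_double {p g : ℂ[X]} (h : IsProperDiscMap p g 3) {ζ : ℂ} (h0 : p.eval ζ = 0)
    (h1 : (derivative p).eval ζ = 0) : ∃ κ μ a : ℂ, κ ≠ 0 ∧ ‖κ‖ = ‖μ‖ ∧ ‖a‖ < 1 ∧
    p = C κ * (X - C ζ) ^ 2 * (X - C a) ∧
    g = C μ * (1 - C (conj ζ) * X) ^ 2 * (1 - C (conj a) * X) := by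
  obtain ⟨κ, μ, a, b, c, hκ, hκμ, ha, hb, hc, rfl, rfl⟩ := cdnf_blaschke h
  simp only [derivative_mul, derivative_sub, derivative_C, derivative_X,
    eval_mul, eval_add, eval_sub, eval_C, eval_X, eval_one, eval_zero] at h0 h1
  simp only [mul_eq_zero, hκ, false_or, sub_eq_zero] at h0
  have hcase : (ζ = a ∧ ζ = b) ∨ (ζ = a ∧ ζ = c) ∨ (ζ = b ∧ ζ = c) := by
    rcases h0 with (rfl | rfl) | rfl
    · have : κ * ((ζ - b) * (ζ - c)) = 0 := by linear_combination h1
      simp only [mul_eq_zero, hκ, false_or, sub_eq_zero] at this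
      tauto
    · have : κ * ((ζ - a) * (ζ - c)) = 0 := by linear_combination h1
      simp only [mul_eq_zero, hκ, false_or, sub_eq_zero] at this
      tauto
    · have : κ * ((ζ - a) * (ζ - b)) = 0 := by linear_combination h1
      simp only [mul_eq_zero, hκ, false_or, sub_eq_zero] at this
      tauto
  rcases hcase with ⟨rfl, rfl⟩ | ⟨rfl, rfl⟩ | ⟨rfl, rfl⟩
  · exact ⟨κ, μ, c, hκ, hκμ, hc, by ring, by ring⟩
  · exact ⟨κ, μ, b, hκ, hκμ, hb, by ring, by ring⟩
  · exact ⟨κ, μ, a, hκ, hκμ, ha, by ring, by ring⟩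

lemma cdnf_eqv_H {p g : ℂ[X]} (h : IsProperDiscMap p g 3) : ∃ r : ℝ, 0 ≤ r ∧ r < 1 ∧
    CdnfEqv (fun z => p.eval z / g.eval z) (cdnfH r) := by
  obtain ⟨ζ, hζ, hW⟩ := cdnf_crit_pg h
  have hgζ := h.2.1 ζ hζ
  set w := p.eval ζ / g.eval ζ with hwdef
  have hw : ‖w‖ < 1 := by
    rw [← cdnf_normSq_lt, hwdef, map_div₀, div_lt_one (Complex.normSq_pos.2 hgζ)]
    exact h.2.2.2.1 ζ hζ
  have hwg : w * g.eval ζ = p.eval ζ := div_mul_cancel₀ _ hgζ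
  have hpost := cdnf_post h hw
  obtain ⟨κ, μ, a, hκ, hκμ, ha, hP, hG⟩ := cdnf_double hpost (ζ := ζ)
    (by simp only [eval_sub, eval_mul, eval_C]; rw [hwg, sub_self])
    (by
      simp only [derivative_sub, derivative_C_mul, eval_sub, eval_mul, eval_C]
      apply mul_right_cancel₀ hgζ
      linear_combination hW - (derivative g).eval ζ * hwg)
  have hμ : μ ≠ 0 := by rw [← norm_pos_iff, ← hκμ, norm_pos_iff]; exact hκ
  -- first step
  set α := (a + -ζ) / (1 + conj (-ζ) * a) with hα
  have hζn : ‖-ζ‖ < 1 := by simpa using hζ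
  have hαn : ‖α‖ < 1 := cdnf_moeb_lt hζn ha
  have hd1 := cdnf_den_ne hζn ha.le
  have hd2 := cdnf_den_ne' ha hζ.le
  set ε := (κ / μ) * ((1 - conj ζ * a) / (1 - conj a * ζ)) with hε
  have hd1' : 1 - conj ζ * a ≠ 0 := cdnf_den_ne' hζ ha.le
  have hεn : ‖ε‖ = 1 := by
    have : ‖1 - conj ζ * a‖ = ‖1 - conj a * ζ‖ := by
      rw [← RCLike.norm_conj]
      simp [mul_comm]
    rw [hε, norm_mul, norm_div, norm_div, this, hκμ, div_self (norm_ne_zero_iff.2 hμ),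
      div_self (norm_ne_zero_iff.2 hd2), one_mul]
  have step1 : CdnfEqv (fun z => p.eval z / g.eval z)
      (fun z => ε * (z ^ 2 * ((z - α) / (1 - conj α * z)))) := by
    refine ⟨cdnfMoeb (-w) (by simpa using hw), cdnfMoeb ζ hζ, fun z hz => ?_⟩
    have hy := cdnf_moeb_lt hζ hz
    have hyd := cdnf_den_ne hζ hz.le
    simp only [cdnfMoeb]
    set y := (z + ζ) / (1 + conj ζ * z) with hydef
    have hyz : y * (1 + conj ζ * z) = z + ζ := div_mul_cancel₀ _ hyd
    have hgy := h.2.1 y hy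
    have hGy := hpost.2.1 y hy
    have s1 : (p.eval y / g.eval y + -w) / (1 + conj (-w) * (p.eval y / g.eval y)) =
        (p - C w * g).eval y / (g - C (conj w) * p).eval y := by
      simp only [eval_sub, eval_mul, eval_C] at hGy ⊢
      have e1 : p.eval y / g.eval y + -w = (p.eval y - w * g.eval y) / g.eval y := by
        field_simp; ring
      have e2 : 1 + conj (-w) * (p.eval y / g.eval y) =
          (g.eval y - conj w * p.eval y) / g.eval y := by
        rw [map_neg]; field_simp; ring
      rw [e1, e2, div_div_div_cancel_right₀ hgy]
    rw [s1, hP, hG]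
    simp only [eval_mul, eval_pow, eval_sub, eval_C, eval_X, eval_one]
    have hy1 : 1 - conj ζ * y ≠ 0 := cdnf_den_ne' hζ hy.le
    have hy2 : 1 - conj a * y ≠ 0 := cdnf_den_ne' ha hy.le
    have f1 : (y - ζ) = z * (1 - conj ζ * y) := by linear_combination hyz
    have hαz : 1 - conj α * z ≠ 0 := cdnf_den_ne' hαn hz.le
    have f2 : α * (1 - conj ζ * a) = a - ζ := by
      have : α * (1 + conj (-ζ) * a) = a + -ζ := div_mul_cancel₀ _ hd1
      rw [map_neg] at this
      linear_combination this
    have f3 : conj α * (1 - ζ * conj a) = conj a - conj ζ := by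
      have := congrArg conj f2
      simpa using this
    have f4 : (y - a) * (1 + conj ζ * z) = (1 - conj ζ * a) * (z - α) := by
      linear_combination hyz + f2
    have f5 : (1 - conj a * y) * (1 + conj ζ * z) = (1 - conj a * ζ) * (1 - conj α * z) := by
      linear_combination (- conj a) * hyz + z * f3
    rw [hε, f1]
    have f6 : (y - a) / (1 - conj a * y) =
        ((1 - conj ζ * a) * (z - α)) / ((1 - conj a * ζ) * (1 - conj α * z)) := by
      rw [← f4, ← f5, mul_div_mul_right _ _ hyd]
    have f7 : ∀ Y Z W : ℂ, Y ≠ 0 → κ * (z * Y) ^ 2 * W / (μ * Y ^ 2 * Z) =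
        κ / μ * z ^ 2 * (W / Z) := by
      intro Y Z W hY
      have : κ * (z * Y) ^ 2 * W / (μ * Y ^ 2 * Z) =
        κ / μ * z ^ 2 * (W / Z) * (Y ^ 2 / Y ^ 2) := by ring
      rw [this, div_self (pow_ne_zero _ hY), mul_one]
    rw [f7 _ _ _ hy1, f6, mul_div_mul_comm]
    ring
  -- rotation
  obtain ⟨u, hu, hαu⟩ : ∃ u : ℂ, ‖u‖ = 1 ∧ α = ‖α‖ * u := by
    refine ⟨Complex.exp (Complex.arg α * Complex.I), Complex.norm_exp_ofReal_mul_I _, ?_⟩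
    exact (Complex.norm_mul_exp_arg_mul_I α).symm
  refine ⟨‖α‖, norm_nonneg _, hαn, step1.trans ?_⟩
  have hu0 : u ≠ 0 := by intro h; simp [h] at hu
  have hε0 : ε ≠ 0 := by intro h; simp [h] at hεn
  have huu : conj u * u = 1 := by
    rw [mul_comm, Complex.mul_conj, Complex.normSq_eq_norm_sq, hu]; simp
  refine ⟨cdnfRot (ε * u ^ 3)⁻¹ (by simp [hεn, hu]), cdnfRot u hu, fun z _ => ?_⟩
  simp only [cdnfRot, cdnfH]
  have g1 : u * z - α = u * (z - ‖α‖) := by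
    linear_combination - hαu
  have g2 : 1 - conj α * (u * z) = 1 - ‖α‖ * z := by
    have : conj α = ‖α‖ * conj u := by
      conv_lhs => rw [hαu]
      simp
    rw [this]
    linear_combination (- (‖α‖:ℂ) * z) * huu
  rw [g1, g2]
  field_simp

/-- For `0 ≤ σ < 1` the map `f_σ(z) = (σz + z³)/(1 + σz²)` is a rational proper map of the
disc of degree `3` in lowest terms, and every rational proper self-map of the disc of degree
`3` is spherically equivalent to `f_σ` for exactly one such `σ`. -/
theorem cubic_disc_normal_form :
    (∀ σ : ℝ, 0 ≤ σ → σ < 1 →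
      IsProperDiscMap (Polynomial.C (σ : ℂ) * Polynomial.X + Polynomial.X ^ 3)
        (1 + Polynomial.C (σ : ℂ) * Polynomial.X ^ 2) 3) ∧
    (∀ p g : Polynomial ℂ, IsProperDiscMap p g 3 →
      ∃! σ : ℝ, (0 ≤ σ ∧ σ < 1) ∧
        ∃ τ ψ : DiscAut, ∀ z : ℂ, ‖z‖ < 1 →
          τ.toFun (p.eval (ψ.toFun z) / g.eval (ψ.toFun z))
            = ((σ : ℂ) * z + z ^ 3) / (1 + (σ : ℂ) * z ^ 2)) := by
  refine ⟨cdnf_part1, fun p g h => ?_⟩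
  obtain ⟨r, hr0, hr1, h1⟩ := cdnf_eqv_H h
  obtain ⟨s, hs0, hs1, h2⟩ := cdnf_H_eqv' hr0 hr1
  have hE := h1.trans h2
  refine ⟨s, ⟨⟨hs0, hs1⟩, hE⟩, ?_⟩
  rintro s' ⟨⟨h0', h1'⟩, hE'⟩
  have hE'' : CdnfEqv (fun z => p.eval z / g.eval z) (cdnfF s') := hE'
  refine cdnf_unique h0' h1' hs0 hs1 ((hE''.symm ?_).trans hE)
  intro z hz
  rw [← cdnf_normSq_lt, map_div₀, div_lt_one (Complex.normSq_pos.2 (h.2.1 z hz))]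
  exact h.2.2.2.1 z hz
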